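/- Let α > 0, let Y be a countable set, and let f, g : {0,1}^n → Y be randomized functions such that for every fixed x* ∈ {0,1}^n, Pr[f(x) = g(x*)] ≤ α, where x is uniform on {0,1}^n and f, g use independent internal randomness. Then for every ρ ∈ [0,1], Pr[f(x̃) = g(x)] ≤ α^{(1/2)·(1−ρ²)/(1+ρ²)}, where x is uniform on {0,1}^n, x̃ ← N_ρ(x), and f, g use independent internal randomness. -/

import Mathlib

/-- The probability that the noise channel `N_ρ` maps `x` to `y`: each bit of `x` is kept
with probability `(1+ρ)/2` and flipped with probability `(1-ρ)/2`. -/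
noncomputable def noiseK (ρ : ℝ) {n : ℕ} (x y : Fin n → Bool) : ℝ :=
  ∏ i, if y i = x i then (1 + ρ) / 2 else (1 - ρ) / 2

open Real Finset

lemma two_mul_le_rpow_one_add_sub_rpow_one_sub {s t : ℝ} (hs0 : 0 ≤ s) (hs1 : s ≤ 1)
    (ht0 : 0 ≤ t) (ht1 : t < 1) : 2 * s * t ≤ (1 + t) ^ s - (1 - t) ^ s := by
  have hd : ∀ x ∈ Set.Ico (0 : ℝ) 1,
      HasDerivAt (fun x : ℝ => (1 + x) ^ s - (1 - x) ^ s - 2 * s * x)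
        (s * ((1 + x) ^ (s - 1) + (1 - x) ^ (s - 1) - 2)) x := by
    intro x hx
    have h1 := ((hasDerivAt_id x).const_add 1).rpow_const (p := s)
      (Or.inl (by simp only [id]; linarith [hx.1]))
    have h2 := ((hasDerivAt_id x).const_sub 1).rpow_const (p := s)
      (Or.inl (by simp only [id]; linarith [hx.2]))
    have h3 := (hasDerivAt_id x).const_mul (2 * s)
    refine ((h1.sub h2).sub h3).congr_deriv ?_
    simp only [id]
    ring
  have hmono : MonotoneOn (fun x : ℝ => (1 + x) ^ s - (1 - x) ^ s - 2 * s * x)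
      (Set.Ico (0 : ℝ) 1) := by
    refine monotoneOn_of_deriv_nonneg (convex_Ico 0 1)
      (fun x hx => (hd x hx).continuousAt.continuousWithinAt)
      (fun x hx => (hd x (interior_subset hx)).differentiableAt.differentiableWithinAt) ?_
    intro x hx
    have hx' := interior_subset hx
    rw [(hd x hx').deriv]
    have hp1 : 0 < 1 + x := by linarith [hx'.1]
    have hp2 : 0 < 1 - x := by linarith [hx'.2]
    have ha := rpow_pos_of_pos hp1 (s - 1)
    have hb := rpow_pos_of_pos hp2 (s - 1)
    have hprod : 1 ≤ (1 + x) ^ (s - 1) * (1 - x) ^ (s - 1) := by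
      rw [← mul_rpow hp1.le hp2.le]
      exact one_le_rpow_of_pos_of_le_one_of_nonpos (mul_pos hp1 hp2)
        (by nlinarith [sq_nonneg x]) (by linarith)
    refine mul_nonneg hs0 ?_
    nlinarith [sq_nonneg ((1 + x) ^ (s - 1) - (1 - x) ^ (s - 1))]
  have h := hmono (Set.left_mem_Ico.2 one_pos) ⟨ht0, ht1⟩ ht0
  simp only [add_zero, sub_zero, mul_zero, sub_self] at h
  linarith

lemma one_add_mul_sq_le_rpow_add_rpow {p t : ℝ} (hp1 : 1 ≤ p) (hp2 : p ≤ 2)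
    (ht0 : 0 ≤ t) (ht1 : t ≤ 1) :
    1 + p * (p - 1) / 2 * t ^ 2 ≤ ((1 + t) ^ p + (1 - t) ^ p) / 2 := by
  have hd : ∀ x : ℝ,
      HasDerivAt (fun x : ℝ => (1 + x) ^ p + (1 - x) ^ p - p * (p - 1) * x ^ 2)
        (p * ((1 + x) ^ (p - 1) - (1 - x) ^ (p - 1) - 2 * (p - 1) * x)) x := by
    intro x
    have h1 := ((hasDerivAt_id x).const_add 1).rpow_const (p := p) (Or.inr hp1)
    have h2 := ((hasDerivAt_id x).const_sub 1).rpow_const (p := p) (Or.inr hp1)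
    have h3 := (hasDerivAt_pow 2 x).const_mul (p * (p - 1))
    refine ((h1.add h2).sub h3).congr_deriv ?_
    simp only [id]
    push_cast
    ring
  have hmono : MonotoneOn (fun x : ℝ => (1 + x) ^ p + (1 - x) ^ p - p * (p - 1) * x ^ 2)
      (Set.Icc (0 : ℝ) 1) := by
    refine monotoneOn_of_deriv_nonneg (convex_Icc 0 1)
      (fun x _ => (hd x).continuousAt.continuousWithinAt)
      (fun x _ => (hd x).differentiableAt.differentiableWithinAt) ?_
    intro x hx
    rw [interior_Icc] at hx
    rw [(hd x).deriv]
    have := two_mul_le_rpow_one_add_sub_rpow_one_sub (s := p - 1) (by linarith) (by linarith)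
      hx.1.le hx.2
    exact mul_nonneg (by linarith) (by linarith)
  have h := hmono (Set.left_mem_Icc.2 zero_le_one) ⟨ht0, ht1⟩ ht0
  norm_num at h
  linarith

/-- The two-point hypercontractive inequality, in terms of mean `a` and half-difference `b`. -/
lemma two_point_hypercontractive {ρ a b : ℝ} (hρ0 : 0 ≤ ρ) (hρ1 : ρ ≤ 1)
    (hb : 0 ≤ b) (hba : b ≤ a) :
    a ^ 2 + ρ ^ 2 * b ^ 2 ≤
      ((((a + b) ^ (1 + ρ ^ 2) + (a - b) ^ (1 + ρ ^ 2)) / 2) ^ (1 / (1 + ρ ^ 2))) ^ 2 := by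
  set r : ℝ := 1 + ρ ^ 2 with hr
  have hr1 : 1 ≤ r := by nlinarith [sq_nonneg ρ]
  have hr2 : r ≤ 2 := by nlinarith
  have hM : 0 ≤ ((a + b) ^ r + (a - b) ^ r) / 2 := by
    have := rpow_nonneg (by linarith : 0 ≤ a + b) r
    have := rpow_nonneg (by linarith : 0 ≤ a - b) r
    linarith
  rcases (hb.trans hba).eq_or_lt with ha | ha
  · obtain rfl : b = 0 := by linarith
    rw [← ha]
    simp only [ne_eq, OfNat.ofNat_ne_zero, not_false_eq_true, zero_pow, mul_zero, add_zero]
    positivity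
  · have ht0 : 0 ≤ b / a := by positivity
    have ht1 : b / a ≤ 1 := (div_le_one ha).2 hba
    have hab1 : a + b = a * (1 + b / a) := by field_simp
    have hab2 : a - b = a * (1 - b / a) := by field_simp
    have hsq : a ^ 2 + ρ ^ 2 * b ^ 2 = a ^ 2 * (1 + ρ ^ 2 * (b / a) ^ 2) := by field_simp
    have key : (a ^ 2 + ρ ^ 2 * b ^ 2) ^ (r / 2) ≤ ((a + b) ^ r + (a - b) ^ r) / 2 := by
      rw [hsq, hab1, hab2, mul_rpow ha.le (by linarith), mul_rpow ha.le (by linarith),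
        mul_rpow (by positivity) (by positivity), ← rpow_natCast a 2, ← rpow_mul ha.le,
        show ((2 : ℕ) : ℝ) * (r / 2) = r by push_cast; ring]
      have h1 := one_add_mul_sq_le_rpow_add_rpow hr1 hr2 ht0 ht1
      have h2 : (1 + ρ ^ 2 * (b / a) ^ 2) ^ (r / 2) ≤ 1 + r / 2 * (ρ ^ 2 * (b / a) ^ 2) :=
        rpow_one_add_le_one_add_mul_self (by nlinarith [sq_nonneg (ρ * (b / a))])
          (by linarith) (by linarith)
      have h3 : r / 2 * (ρ ^ 2 * (b / a) ^ 2) = r * (r - 1) / 2 * (b / a) ^ 2 := by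
        rw [hr]; ring
      have := mul_le_mul_of_nonneg_left (h2.trans (h3 ▸ h1)) (rpow_nonneg ha.le r)
      linarith
    have hL : 0 ≤ a ^ 2 + ρ ^ 2 * b ^ 2 := by positivity
    calc a ^ 2 + ρ ^ 2 * b ^ 2 = ((a ^ 2 + ρ ^ 2 * b ^ 2) ^ (r / 2)) ^ (2 / r) := by
          rw [← rpow_mul hL, show r / 2 * (2 / r) = 1 by field_simp, rpow_one]
      _ ≤ (((a + b) ^ r + (a - b) ^ r) / 2) ^ (2 / r) :=
          rpow_le_rpow (rpow_nonneg hL _) key (by positivity)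
      _ = _ := by
          rw [← rpow_natCast, ← rpow_mul hM]
          congr 1
          push_cast
          ring

lemma two_point_bilinear_hypercontractive {ρ u₀ u₁ v₀ v₁ : ℝ} (hρ0 : 0 ≤ ρ) (hρ1 : ρ ≤ 1)
    (hu₀ : 0 ≤ u₀) (hu₁ : 0 ≤ u₁) :
    ((1 + ρ) / 2 * (u₀ * v₀ + u₁ * v₁) + (1 - ρ) / 2 * (u₀ * v₁ + u₁ * v₀)) / 2 ≤
      ((u₀ ^ (1 + ρ ^ 2) + u₁ ^ (1 + ρ ^ 2)) / 2) ^ (1 / (1 + ρ ^ 2)) *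
        √((v₀ ^ 2 + v₁ ^ 2) / 2) := by
  wlog h : u₁ ≤ u₀ generalizing u₀ u₁ v₀ v₁
  · have := this (v₀ := v₁) (v₁ := v₀) hu₁ hu₀ (le_of_not_ge h)
    rw [add_comm (u₀ ^ _), add_comm (v₀ ^ 2)]
    refine le_trans (le_of_eq ?_) this
    ring
  have htp := two_point_hypercontractive (a := (u₀ + u₁) / 2) (b := (u₀ - u₁) / 2) hρ0 hρ1
    (by linarith) (by linarith)
  rw [show (u₀ + u₁) / 2 + (u₀ - u₁) / 2 = u₀ by ring,
    show (u₀ + u₁) / 2 - (u₀ - u₁) / 2 = u₁ by ring] at htp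
  have hM : 0 ≤ ((u₀ ^ (1 + ρ ^ 2) + u₁ ^ (1 + ρ ^ 2)) / 2) ^ (1 / (1 + ρ ^ 2)) := by positivity
  refine abs_le_of_sq_le_sq' ?_ (by positivity) |>.2
  rw [mul_pow, sq_sqrt (by positivity)]
  refine le_trans ?_ (mul_le_mul_of_nonneg_right htp (by positivity))
  nlinarith [sq_nonneg (((u₀ + u₁) / 2 + ρ * ((u₀ - u₁) / 2)) * v₁
    - ((u₀ + u₁) / 2 - ρ * ((u₀ - u₁) / 2)) * v₀)]

lemma sum_fin_succ_bool {M : Type*} [AddCommMonoid M] {n : ℕ} (f : (Fin (n + 1) → Bool) → M) :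
    ∑ x, f x = ∑ x, f (Fin.cons true x) + ∑ x, f (Fin.cons false x) := by
  rw [← (Fin.consEquiv fun _ => Bool).sum_comp, Fintype.sum_prod_type, Fintype.sum_bool]
  rfl

lemma noiseK_cons {ρ : ℝ} {n : ℕ} (b c : Bool) (x y : Fin n → Bool) :
    noiseK ρ (Fin.cons b x : Fin (n + 1) → Bool) (Fin.cons c y) =
      (if c = b then (1 + ρ) / 2 else (1 - ρ) / 2) * noiseK ρ x y := by
  simp [noiseK, Fin.prod_univ_succ]

lemma noiseK_bilinear_hypercontractive {ρ : ℝ} (hρ0 : 0 ≤ ρ) (hρ1 : ρ ≤ 1) {n : ℕ}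
    (F G : (Fin n → Bool) → ℝ) (hF : ∀ x, 0 ≤ F x) :
    ∑ x, (2 ^ n : ℝ)⁻¹ * ∑ y, noiseK ρ x y * (F y * G x) ≤
      ((2 ^ n : ℝ)⁻¹ * ∑ x, F x ^ (1 + ρ ^ 2)) ^ (1 / (1 + ρ ^ 2)) *
        √((2 ^ n : ℝ)⁻¹ * ∑ x, G x ^ 2) := by
  have hr : 0 < 1 + ρ ^ 2 := by positivity
  induction n with
  | zero =>
    simp only [noiseK, Finset.univ_unique, Finset.sum_singleton, pow_zero, inv_one, one_mul,
      Finset.univ_eq_empty, Finset.prod_empty]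
    rw [← rpow_mul (hF _), mul_one_div_cancel hr.ne', rpow_one, sqrt_sq_eq_abs]
    exact mul_le_mul_of_nonneg_left (le_abs_self _) (hF _)
  | succ n ih =>
    have hI (b c : Bool) := ih (fun x => F (Fin.cons b x)) (fun x => G (Fin.cons c x))
      (fun x => hF _)
    set B : Bool → Bool → ℝ := fun b c =>
      ∑ x, (2 ^ n : ℝ)⁻¹ * ∑ y, noiseK ρ x y * (F (Fin.cons b y) * G (Fin.cons c x)) with hB
    set S : Bool → ℝ := fun b => (2 ^ n : ℝ)⁻¹ * ∑ x, F (Fin.cons b x) ^ (1 + ρ ^ 2) with hS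
    set R : Bool → ℝ := fun c => (2 ^ n : ℝ)⁻¹ * ∑ x, G (Fin.cons c x) ^ 2 with hR
    have hS0 (b : Bool) : 0 ≤ S b :=
      mul_nonneg (by positivity) (Finset.sum_nonneg fun x _ => rpow_nonneg (hF _) _)
    have hR0 (b : Bool) : 0 ≤ R b := by positivity
    have hSr (b : Bool) : (S b ^ (1 / (1 + ρ ^ 2))) ^ (1 + ρ ^ 2) = S b := by
      rw [← rpow_mul (hS0 b), one_div_mul_cancel hr.ne', rpow_one]
    have hI' (b c : Bool) : B b c ≤ S b ^ (1 / (1 + ρ ^ 2)) * √(R c) := hI b c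
    have hsplit : ∑ x, (2 ^ (n + 1) : ℝ)⁻¹ * ∑ y, noiseK ρ x y * (F y * G x) =
        ((1 + ρ) / 2 * (B true true + B false false) +
          (1 - ρ) / 2 * (B true false + B false true)) / 2 := by
      simp only [sum_fin_succ_bool, noiseK_cons, hB, mul_add, Finset.sum_add_distrib,
        Finset.mul_sum, Finset.sum_div, add_div, pow_succ, mul_inv, if_true, reduceCtorEq,
        if_false]
      have e (k : ℝ) (f : (Fin n → Bool) → (Fin n → Bool) → ℝ)
          (b c : Bool) : ∑ x, ∑ y, (2 ^ n : ℝ)⁻¹ * 2⁻¹ * (k * f x y *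
            (F (Fin.cons b y) * G (Fin.cons c x))) =
          ∑ x, ∑ y, k * ((2 ^ n : ℝ)⁻¹ * (f x y * (F (Fin.cons b y) * G (Fin.cons c x)))) / 2 :=
        Finset.sum_congr rfl fun x _ => Finset.sum_congr rfl fun y _ => by ring
      simp only [e]
      ring
    have hSsplit : (2 ^ (n + 1) : ℝ)⁻¹ * ∑ x, F x ^ (1 + ρ ^ 2) = (S true + S false) / 2 := by
      rw [sum_fin_succ_bool, hS, pow_succ, mul_inv]
      ring
    have hRsplit : (2 ^ (n + 1) : ℝ)⁻¹ * ∑ x, G x ^ 2 = (R true + R false) / 2 := by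
      rw [sum_fin_succ_bool, hR, pow_succ, mul_inv]
      ring
    rw [hsplit, hSsplit, hRsplit]
    have h2 := two_point_bilinear_hypercontractive (v₀ := √(R true)) (v₁ := √(R false)) hρ0 hρ1
      (rpow_nonneg (hS0 true) (1 / (1 + ρ ^ 2))) (rpow_nonneg (hS0 false) (1 / (1 + ρ ^ 2)))
    rw [hSr, hSr, sq_sqrt (hR0 _), sq_sqrt (hR0 _)] at h2
    refine le_trans ?_ h2
    have : 0 ≤ (1 - ρ) / 2 := by linarith
    gcongr <;> exact hI' _ _

lemma rpow_mul_sqrt_le {α μ ν θ : ℝ} (hα : 0 < α) (hμ : 0 ≤ μ) (hν : 0 ≤ ν)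
    (hθ0 : 0 ≤ θ) (hθ1 : 2 * θ ≤ 1) :
    μ ^ (1 / 2 + θ) * √ν ≤
      α ^ θ / 2 * (μ + (1 - 2 * θ) * ν + 2 * θ / α * (μ * ν)) := by
  have htan : (μ / α) ^ (2 * θ) ≤ 1 + 2 * θ * (μ / α - 1) := by
    have := rpow_one_add_le_one_add_mul_self (s := μ / α - 1) (p := 2 * θ)
      (by linarith [div_nonneg hμ hα.le]) (by linarith) hθ1
    rwa [add_sub_cancel] at this
  have hz : (μ / α) ^ (2 * θ) = ((μ / α) ^ θ) ^ 2 := by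
    rw [← rpow_natCast, ← rpow_mul (by positivity), mul_comm]; norm_num
  have hμθ : μ ^ (1 / 2 + θ) = √μ * (α ^ θ * (μ / α) ^ θ) := by
    rw [rpow_add_of_nonneg hμ (by norm_num) hθ0, ← sqrt_eq_rpow, ← mul_rpow hα.le (by positivity),
      mul_div_cancel₀ _ hα.ne']
  have hamgm : √μ * ((μ / α) ^ θ * √ν) ≤ (μ + (μ / α) ^ (2 * θ) * ν) / 2 := by
    have := sq_nonneg (√μ - (μ / α) ^ θ * √ν)
    rw [hz]
    nlinarith [sq_sqrt hμ, sq_sqrt hν]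
  have hαθ : 0 ≤ α ^ θ := by positivity
  calc μ ^ (1 / 2 + θ) * √ν = α ^ θ * (√μ * ((μ / α) ^ θ * √ν)) := by rw [hμθ]; ring
    _ ≤ α ^ θ * ((μ + (1 + 2 * θ * (μ / α - 1)) * ν) / 2) := by
        refine mul_le_mul_of_nonneg_left (hamgm.trans ?_) hαθ
        gcongr
    _ = _ := by ring

/-- Let `α > 0`, let `Y` be a countable set, and let
`f, g : {0,1}^n → Y` be randomized functions (given by their kernels `p`, `q`, where
`p x y = Pr[f(x) = y]` and `q x y = Pr[g(x) = y]`) such that for every fixed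
`x* ∈ {0,1}^n`, `Pr[f(x) = g(x*)] ≤ α` over uniform `x` and independent internal
randomness of `f` and `g`.  Then for every `ρ ∈ [0,1]`,
`Pr[f(x̃) = g(x)] ≤ α^{(1/2)·(1−ρ²)/(1+ρ²)}` where `x` is uniform on `{0,1}^n` and
`x̃ ← N_ρ(x)`. -/
theorem randomized_collision_bound {n : ℕ} {Y : Type*} [Countable Y]
    (α : ℝ) (hα : 0 < α)
    (p q : (Fin n → Bool) → Y → ℝ)
    (hp0 : ∀ x y, 0 ≤ p x y) (hp1 : ∀ x, ∑' y, p x y = 1)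
    (hq0 : ∀ x y, 0 ≤ q x y) (hq1 : ∀ x, ∑' y, q x y = 1)
    (hcol : ∀ xs : Fin n → Bool,
      ∑ x, (2 ^ n : ℝ)⁻¹ * ∑' y, p x y * q xs y ≤ α)
    (ρ : ℝ) (hρ : ρ ∈ Set.Icc (0 : ℝ) 1) :
    ∑ x, (2 ^ n : ℝ)⁻¹ * ∑ xt, noiseK ρ x xt * ∑' y, p xt y * q x y
      ≤ α ^ ((1 / 2) * ((1 - ρ ^ 2) / (1 + ρ ^ 2))) := by
  obtain ⟨hρ0, hρ1⟩ := hρ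
  have hr : 0 < 1 + ρ ^ 2 := by positivity
  set θ : ℝ := 1 / 2 * ((1 - ρ ^ 2) / (1 + ρ ^ 2)) with hθ
  have hθr : 1 / (1 + ρ ^ 2) = 1 / 2 + θ := by rw [hθ]; field_simp; ring
  have hθ0 : 0 ≤ θ :=
    mul_nonneg (by norm_num) (div_nonneg (by nlinarith) hr.le)
  have hθ1 : 2 * θ ≤ 1 := by
    have : 1 / (1 + ρ ^ 2) ≤ 1 := (div_le_one hr).2 (by nlinarith [sq_nonneg ρ])
    linarith
  have hps (x) : HasSum (p x) 1 := by
    have : Summable (p x) := by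
      by_contra h
      simpa [tsum_eq_zero_of_not_summable h] using hp1 x
    exact hp1 x ▸ this.hasSum
  have hqs (x) : HasSum (q x) 1 := by
    have : Summable (q x) := by
      by_contra h
      simpa [tsum_eq_zero_of_not_summable h] using hq1 x
    exact hq1 x ▸ this.hasSum
  have hple (x y) : p x y ≤ 1 := le_hasSum (hps x) y fun _ _ => hp0 x _
  have hqle (x y) : q x y ≤ 1 := le_hasSum (hqs x) y fun _ _ => hq0 x _
  have hpq (x x') : HasSum (fun y => p x y * q x' y) (∑' y, p x y * q x' y) :=
    (Summable.of_nonneg_of_le (fun y => mul_nonneg (hp0 _ _) (hq0 _ _))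
      (fun y => mul_le_of_le_one_right (hp0 _ _) (hqle _ _)) (hps x).summable).hasSum
  have hcard : ∑ _x : Fin n → Bool, (2 ^ n : ℝ)⁻¹ = 1 := by simp
  set μ : Y → ℝ := fun y => ∑ x, (2 ^ n : ℝ)⁻¹ * p x y with hμ
  set ν : Y → ℝ := fun y => ∑ x, (2 ^ n : ℝ)⁻¹ * q x y with hν
  have hμ0 (y) : 0 ≤ μ y :=
    Finset.sum_nonneg fun x _ => mul_nonneg (by positivity) (hp0 x y)
  have hν0 (y) : 0 ≤ ν y :=
    Finset.sum_nonneg fun x _ => mul_nonneg (by positivity) (hq0 x y)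
  have hμs : HasSum μ 1 := by
    have := hasSum_sum (s := Finset.univ) fun x _ => (hps x).mul_left (2 ^ n : ℝ)⁻¹
    simpa only [mul_one, hcard] using this
  have hνs : HasSum ν 1 := by
    have := hasSum_sum (s := Finset.univ) fun x _ => (hqs x).mul_left (2 ^ n : ℝ)⁻¹
    simpa only [mul_one, hcard] using this
  have hμνs : HasSum (fun y => μ y * ν y)
      (∑ xs, (2 ^ n : ℝ)⁻¹ * ∑ x, (2 ^ n : ℝ)⁻¹ * ∑' y, p x y * q xs y) := by
    have := hasSum_sum (s := Finset.univ) fun xs _ => (hasSum_sum (s := Finset.univ) fun x _ =>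
      (hpq x xs).mul_left (2 ^ n : ℝ)⁻¹).mul_left (2 ^ n : ℝ)⁻¹
    refine this.congr_fun ?_
    intro y
    rw [hμ, hν, mul_comm, Finset.sum_mul_sum]
    simp only [Finset.mul_sum]
    exact Finset.sum_congr rfl fun _ _ => Finset.sum_congr rfl fun _ _ => by ring
  have hμνα : ∑ xs, (2 ^ n : ℝ)⁻¹ * ∑ x, (2 ^ n : ℝ)⁻¹ * ∑' y, p x y * q xs y ≤ α :=
    calc _ ≤ ∑ _xs : Fin n → Bool, (2 ^ n : ℝ)⁻¹ * α :=
          Finset.sum_le_sum fun xs _ => mul_le_mul_of_nonneg_left (hcol xs) (by positivity)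
      _ = α := by rw [← Finset.sum_mul, hcard, one_mul]
  have hL : HasSum (fun y => ∑ x, (2 ^ n : ℝ)⁻¹ * ∑ xt, noiseK ρ x xt * (p xt y * q x y))
      (∑ x, (2 ^ n : ℝ)⁻¹ * ∑ xt, noiseK ρ x xt * ∑' y, p xt y * q x y) :=
    hasSum_sum fun x _ => (hasSum_sum fun xt _ => (hpq xt x).mul_left _).mul_left _
  have hR := ((hμs.add (hνs.mul_left (1 - 2 * θ))).add (hμνs.mul_left (2 * θ / α))).mul_left
    (α ^ θ / 2)
  refine (hasSum_le (fun y => ?_) hL hR).trans ?_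
  · refine (noiseK_bilinear_hypercontractive hρ0 hρ1 (fun x => p x y) (fun x => q x y)
      (fun x => hp0 x y)).trans (le_trans ?_
      (rpow_mul_sqrt_le hα (hμ0 y) (hν0 y) hθ0 hθ1))
    have hP : (2 ^ n : ℝ)⁻¹ * ∑ x, p x y ^ (1 + ρ ^ 2) ≤ μ y := by
      simp only [hμ, ← Finset.mul_sum]
      gcongr with x
      exact rpow_le_self_of_le_one (hp0 x y) (hple x y) (by nlinarith [sq_nonneg ρ])
    have hQ : (2 ^ n : ℝ)⁻¹ * ∑ x, q x y ^ 2 ≤ ν y := by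
      simp only [hν, ← Finset.mul_sum]
      gcongr with x
      exact pow_le_of_le_one (hq0 x y) (hqle x y) two_ne_zero
    rw [← hθr]
    exact mul_le_mul (rpow_le_rpow (mul_nonneg (by positivity)
      (Finset.sum_nonneg fun x _ => rpow_nonneg (hp0 x y) _)) hP (by positivity))
      (sqrt_le_sqrt hQ) (sqrt_nonneg _) (rpow_nonneg (hμ0 y) _)
  · have h1 := mul_le_mul_of_nonneg_left hμνα (by positivity : 0 ≤ 2 * θ / α)
    rw [div_mul_cancel₀ _ hα.ne'] at h1
    have h2 := mul_le_mul_of_nonneg_left h1 (by positivity : 0 ≤ α ^ θ / 2)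
    linarith
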